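/- Let $0 < \alpha < \beta < 1$ and let $n$ be a positive integer such that $k = \frac{\beta - \alpha}{1-\alpha} n$ and $\beta n$ are integers. Then $\frac{\binom{n}{k}}{\binom{\beta n}{k}} \alpha^k \le e^{-D(\beta\|\alpha) n}$, where $D(\beta\|\alpha) = \beta \ln(\beta/\alpha) + (1-\beta)\ln((1-\beta)/(1-\alpha))$. -/

import Mathlib

/-- The sequence `(1 + 1 / n) ^ n` is nondecreasing, in a division-free form. -/
theorem succ_pow_mul_add_pow_le (a b : ℕ) :
    ((a : ℝ) + 1) ^ a * ((a : ℝ) + b) ^ (a + b) ≤ (a : ℝ) ^ a * ((a : ℝ) + b + 1) ^ (a + b) := by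
  rcases Nat.eq_zero_or_pos a with rfl | ha
  · simp only [Nat.cast_zero, pow_zero, one_mul, zero_add]
    gcongr
    linarith
  have ha' : (0 : ℝ) < a := by exact_mod_cast ha
  have hab : (0 : ℝ) < (a : ℝ) + b := by positivity
  have bern : 1 + ((a : ℝ) + b) / a * (1 / ((a : ℝ) + b)) ≤
      (1 + 1 / ((a : ℝ) + b)) ^ (((a : ℝ) + b) / a) := by
    apply one_add_mul_self_le_rpow_one_add
    · linarith [show (0 : ℝ) ≤ 1 / ((a : ℝ) + b) by positivity]
    · rw [le_div_iff₀ ha']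
      linarith [show (0 : ℝ) ≤ b by positivity]
  have base : (((a : ℝ) + 1) / a) ^ a ≤ (((a : ℝ) + b + 1) / ((a : ℝ) + b)) ^ (a + b) := by
    calc (((a : ℝ) + 1) / a) ^ a = (1 + ((a : ℝ) + b) / a * (1 / ((a : ℝ) + b))) ^ a := by
          congr 1
          field_simp
      _ ≤ ((1 + 1 / ((a : ℝ) + b)) ^ (((a : ℝ) + b) / a)) ^ a := by gcongr
      _ = (1 + 1 / ((a : ℝ) + b)) ^ (a + b) := by
          rw [← Real.rpow_natCast, ← Real.rpow_mul (by positivity), div_mul_cancel₀ _ ha'.ne',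
            ← Real.rpow_natCast, Nat.cast_add]
      _ = _ := by
          congr 1
          field_simp
  rw [div_pow, div_pow, div_le_div_iff₀ (by positivity) (by positivity)] at base
  linarith

/-- The weight of the mode of a binomial distribution with `b` failures decreases as the number
of successes grows. -/
theorem antitone_choose_mul_pow_div (b : ℕ) (hb : 0 < b) :
    Antitone fun a : ℕ ↦ ((a + b).choose b : ℝ) * (a : ℝ) ^ a / ((a : ℝ) + b) ^ (a + b) := by
  refine antitone_nat_of_succ_le fun a ↦ ?_
  have hb' : (0 : ℝ) < b := by exact_mod_cast hb
  have rec_choose : ((a + 1 + b).choose b : ℝ) * (a + 1) = (a + b + 1) * (a + b).choose b := by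
    have h := Nat.add_one_mul_choose_eq (a + b) a
    rw [Nat.choose_symm_add, show a + b + 1 = a + 1 + b by ring, Nat.choose_symm_add] at h
    have h' : (((a + 1 + b) * (a + b).choose b : ℕ) : ℝ) =
      ((a + 1 + b).choose b * (a + 1) : ℕ) := by exact_mod_cast h
    push_cast at h'
    linarith
  have hstep := succ_pow_mul_add_pow_le a b
  rw [div_le_div_iff₀ (by positivity) (by positivity)]
  push_cast
  calc ((a + 1 + b).choose b : ℝ) * ((a : ℝ) + 1) ^ (a + 1) * ((a : ℝ) + b) ^ (a + b)
      = ((a + 1 + b).choose b * ((a : ℝ) + 1)) *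
          (((a : ℝ) + 1) ^ a * ((a : ℝ) + b) ^ (a + b)) := by ring
    _ ≤ ((a : ℝ) + b + 1) * (a + b).choose b * ((a : ℝ) ^ a * ((a : ℝ) + b + 1) ^ (a + b)) := by
        rw [rec_choose]
        gcongr
    _ = _ := by
        rw [show a + 1 + b = a + b + 1 by ring, show (a : ℝ) + 1 + b = a + b + 1 by ring]
        ring

theorem choose_div_choose_eq (a b k : ℕ) :
    ((a + k + b).choose k : ℝ) / ((a + k).choose k : ℝ) =
      ((a + k + b).choose b : ℝ) / ((a + b).choose b : ℝ) := by
  have h := Nat.choose_mul (n := a + k + b) (k := a + k) (s := k) (by omega)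
  rw [Nat.choose_symm_add, show a + k + b - k = a + b by omega, Nat.add_sub_cancel,
    Nat.choose_symm_add] at h
  have h₁ : ((a + k).choose k : ℝ) ≠ 0 := by
    exact_mod_cast (Nat.choose_pos (by omega)).ne'
  have h₂ : ((a + b).choose b : ℝ) ≠ 0 := by
    exact_mod_cast (Nat.choose_pos (by omega)).ne'
  rw [div_eq_div_iff h₁ h₂]
  exact_mod_cast h.symm

theorem exp_neg_relative_entropy_mul {α β : ℝ} (hα : 0 < α) (hα1 : α < 1) (hβ : 0 < β)
    (hβ1 : β < 1) {n m b : ℕ} (hm : (m : ℝ) = β * n) (hb : (b : ℝ) = (1 - β) * n) :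
    Real.exp (-(β * Real.log (β / α) + (1 - β) * Real.log ((1 - β) / (1 - α))) * n) =
      (α / β) ^ m * ((1 - α) / (1 - β)) ^ b := by
  have h₁ : 0 < 1 - α := by linarith
  have h₂ : 0 < 1 - β := by linarith
  rw [← Real.exp_log (show 0 < (α / β) ^ m * ((1 - α) / (1 - β)) ^ b by positivity),
    Real.log_mul (by positivity) (by positivity), Real.log_pow, Real.log_pow, hm, hb,
    ← inv_div β α, ← inv_div (1 - β) (1 - α), Real.log_inv, Real.log_inv]
  congr 1
  ring

theorem stmt_6 (α β : ℝ) (hα : 0 < α) (hαβ : α < β) (hβ1 : β < 1)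
    (n k m : ℕ) (hn : 0 < n) (hk : (k : ℝ) = (β - α) / (1 - α) * n)
    (hm : (m : ℝ) = β * n) :
    (Nat.choose n k : ℝ) / (Nat.choose m k : ℝ) * α ^ k ≤
      Real.exp (-(β * Real.log (β / α) + (1 - β) * Real.log ((1 - β) / (1 - α))) * n) := by
  have hn' : (0 : ℝ) < n := by exact_mod_cast hn
  have hα1 : 0 < 1 - α := by linarith
  have hβ1' : 0 < 1 - β := by linarith
  have hβ : 0 < β := by linarith
  have hk' : (k : ℝ) * (1 - α) = (β - α) * n := by
    rw [hk]
    field_simp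
  have hmk : (m : ℝ) - k = α * (n - k) := by linarith
  have hkn : (k : ℝ) < n := by
    by_contra! h
    nlinarith [mul_pos hβ1' hn', mul_le_mul_of_nonneg_right h hα1.le]
  have hkm : k ≤ m := by
    have : (0 : ℝ) < m - k := hmk ▸ mul_pos hα (by linarith)
    exact_mod_cast (by linarith : (k : ℝ) ≤ m)
  have hmn : m ≤ n := by
    have := mul_pos hβ1' hn'
    exact_mod_cast (by linarith : (m : ℝ) ≤ n)
  obtain ⟨a, rfl⟩ := Nat.exists_eq_add_of_le' hkm
  obtain ⟨b, rfl⟩ := Nat.exists_eq_add_of_le hmn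
  push_cast at *
  have hb : (b : ℝ) = (1 - β) * ((a + k + b : ℕ) : ℝ) := by
    push_cast
    linarith
  have hb0 : (0 : ℝ) < b := hb ▸ mul_pos hβ1' (by push_cast; exact hn')
  have hab : (0 : ℝ) < (a : ℝ) + b := by linarith
  have haα : (a : ℝ) = α * (a + b) := by linarith
  have ha0 : (0 : ℝ) < a := haα ▸ mul_pos hα hab
  have hN : ((a + k + b : ℕ) : ℝ) = a + k + b := by push_cast; rfl
  rw [← hN, exp_neg_relative_entropy_mul hα (by linarith) hβ hβ1 (m := a + k)
    (by push_cast; exact hm) hb, choose_div_choose_eq]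
  have key := antitone_choose_mul_pow_div b (by exact_mod_cast hb0) (Nat.le_add_right a k)
  have eα : α = a / (a + b) := by
    rw [eq_div_iff hab.ne']
    exact haα.symm
  have eα' : 1 - α = b / (a + b) := by
    rw [eα]
    field_simp
    ring
  have eβ : β = (a + k) / (a + k + b) := by
    rw [eq_div_iff hn'.ne']
    exact hm.symm
  have eβ' : 1 - β = b / (a + k + b) := by
    rw [eβ]
    field_simp
    ring
  have hC : (0 : ℝ) < (a + b).choose b := by
    exact_mod_cast Nat.choose_pos (by omega)
  have hak : (0 : ℝ) < (a : ℝ) + k := by positivity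
  rw [eα', eβ', eβ, eα]
  push_cast at key
  rw [div_le_div_iff₀ (by positivity) (by positivity)] at key
  rw [show (b : ℝ) / (a + b) / (b / (a + k + b)) = (a + k + b) / (a + b) by field_simp]
  simp only [div_pow]
  rw [div_mul_div_comm, div_div_div_eq, div_mul_div_comm,
    div_le_div_iff₀ (by positivity) (by positivity)]
  calc _ = (((a + k + b).choose b : ℝ) * ((a : ℝ) + k) ^ (a + k) * ((a : ℝ) + b) ^ (a + b)) *
        ((a : ℝ) ^ k * ((a : ℝ) + b) ^ k) := by ring
    _ ≤ (((a + b).choose b : ℝ) * (a : ℝ) ^ a * ((a : ℝ) + k + b) ^ (a + k + b)) *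
        ((a : ℝ) ^ k * ((a : ℝ) + b) ^ k) := by gcongr
    _ = _ := by ring
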